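/- Let $H$ be a complex Hilbert space and let $\varepsilon, K$ be real numbers with $\varepsilon \ge 0$ and $4\varepsilon K^2 < 1$. Let $\nabla$ be a closed, densely defined operator on $H$ such that the range of $\nabla$ is contained in the domain of $\nabla$ and $\|\nabla^2\| \le \varepsilon^2$, i.e. for every $v \in \operatorname{dom}\nabla$ one has $\nabla v \in \operatorname{dom}\nabla$ and $\|\nabla(\nabla v)\| \le \varepsilon^2 \|v\|$. Suppose there exist bounded operators $x$ and $y$ on $H$ such that $x$ maps $\operatorname{dom}\nabla$ into $\operatorname{dom}\nabla$, $x\nabla v + \nabla(xv) = yv$ for every $v \in \operatorname{dom}\nabla$, $y$ is invertible in the bounded operators, $y^{-1}$ maps $\operatorname{dom}\nabla$ into $\operatorname{dom}\nabla$, $\|x\| \le K$ and $\|y^{-1}\| \le K$. Then the operator $\nabla + \nabla^*$, with domain $\operatorname{dom}\nabla \cap \operatorname{dom}\nabla^*$, is invertible: it is a bijection from its domain onto $H$ whose inverse is a bounded operator. -/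

import Mathlib

/-- An unbounded operator `T` on a Hilbert space `H` is invertible if it is a bijection
from its domain onto `H` whose inverse is a bounded operator, i.e. there is a bounded
operator `B` which is a left inverse of `T` on its domain and a right inverse of `T` on
all of `H` (with values in the domain of `T`). -/
def LinearPMap.IsBoundedInvertible {H : Type*} [NormedAddCommGroup H]
    [InnerProductSpace ℂ H] (T : H →ₗ.[ℂ] H) : Prop :=
  ∃ B : H →L[ℂ] H, (∀ v : T.domain, B (T v) = (v : H)) ∧
    ∀ w : H, ∃ h : B w ∈ T.domain, T ⟨B w, h⟩ = w

open scoped InnerProductSpace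

section SquareZero

variable {G : Type*} [NormedAddCommGroup G] [InnerProductSpace ℂ G] [CompleteSpace G]

/-- The right inverse of `D + D*` built from a contracting homotopy `h` of a square-zero operator
`D` with kernel `M`. -/
noncomputable def hodgeInverse (M : Submodule ℂ G) [M.HasOrthogonalProjection] (h : G →L[ℂ] G) :
    G →L[ℂ] G :=
  Mᗮ.starProjection ∘L h ∘L M.starProjection +
    M.starProjection ∘L h.adjoint ∘L Mᗮ.starProjection

lemma hodgeInverse_apply (M : Submodule ℂ G) [M.HasOrthogonalProjection] (h : G →L[ℂ] G) (w : G) :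
    hodgeInverse M h w = Mᗮ.starProjection (h (M.starProjection w)) +
      M.starProjection (h.adjoint (Mᗮ.starProjection w)) := rfl

lemma norm_hodgeInverse_le (M : Submodule ℂ G) [M.HasOrthogonalProjection] (h : G →L[ℂ] G) :
    ‖hodgeInverse M h‖ ≤ ‖h‖ := by
  refine ContinuousLinearMap.opNorm_le_bound _ (norm_nonneg _) fun w => ?_
  refine le_of_sq_le_sq ?_ (by positivity)
  rw [hodgeInverse_apply]
  set p := M.starProjection w
  set q := Mᗮ.starProjection w
  have horth : ⟪Mᗮ.starProjection (h p), M.starProjection (h.adjoint q)⟫_ℂ = 0 :=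
    M.inner_left_of_mem_orthogonal (M.starProjection_apply_mem _) (Mᗮ.starProjection_apply_mem _)
  have h1 : ‖Mᗮ.starProjection (h p)‖ ≤ ‖h‖ * ‖p‖ :=
    (Mᗮ.norm_starProjection_apply_le _).trans (h.le_opNorm _)
  have h2 : ‖M.starProjection (h.adjoint q)‖ ≤ ‖h‖ * ‖q‖ :=
    (M.norm_starProjection_apply_le _).trans
      ((h.adjoint.le_opNorm _).trans_eq (by rw [LinearIsometryEquiv.norm_map]))
  have h3 := M.norm_sq_eq_add_norm_sq_starProjection w
  have h4 := norm_add_sq_eq_norm_sq_add_norm_sq_of_inner_eq_zero _ _ horth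
  have h5 := pow_le_pow_left₀ (norm_nonneg _) h1 2
  have h6 := pow_le_pow_left₀ (norm_nonneg _) h2 2
  calc _ = _ := by rw [sq, h4]
    _ ≤ (‖h‖ * ‖p‖) ^ 2 + (‖h‖ * ‖q‖) ^ 2 := by nlinarith
    _ = (‖h‖ * ‖w‖) ^ 2 := by rw [mul_pow ‖h‖ ‖w‖, h3]; ring

/-- If the linear relation `Γ` has range in `M`, vanishes on `M` and has `h` as contracting
homotopy, then `hodgeInverse M h` is a right inverse of the sum of `Γ` and its adjoint. -/
lemma exists_hodgeInverse_decomposition (Γ : Submodule ℂ (G × G)) (M : Submodule ℂ G)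
    [M.HasOrthogonalProjection] (h : G →L[ℂ] G)
    (hker : ∀ m ∈ M, (m, 0) ∈ Γ) (hran : ∀ u v, (u, v) ∈ Γ → v ∈ M)
    (hh : ∀ u v, (u, v) ∈ Γ → (h u, u - h v) ∈ Γ) (w : G) :
    ∃ t z, (hodgeInverse M h w, t) ∈ Γ ∧ t + z = w ∧
      ∀ u v, (u, v) ∈ Γ → ⟪z, u⟫_ℂ = ⟪hodgeInverse M h w, v⟫_ℂ := by
  rw [hodgeInverse_apply]
  refine ⟨M.starProjection w, Mᗮ.starProjection w, ?_,
    M.starProjection_add_starProjection_orthogonal w, fun u v huv => ?_⟩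
  · set p := M.starProjection w
    have h1 := hh _ _ (hker p (M.starProjection_apply_mem w))
    have h2 := hker _ (M.starProjection_apply_mem (h p))
    have h3 := hker _ (M.starProjection_apply_mem (h.adjoint (Mᗮ.starProjection w)))
    have h4 := Γ.add_mem (Γ.sub_mem h1 h2) h3
    rw [M.starProjection_orthogonal_val]
    simpa using h4
  · set q := Mᗮ.starProjection w
    have hq : q ∈ Mᗮ := Mᗮ.starProjection_apply_mem w
    have hv := hran _ _ huv
    have hd := hran _ _ (hh _ _ huv)
    rw [inner_add_left, M.inner_left_of_mem_orthogonal hv (Mᗮ.starProjection_apply_mem _),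
      zero_add, M.inner_starProjection_left_eq_right, M.starProjection_eq_self_iff.2 hv,
      ContinuousLinearMap.adjoint_inner_left]
    have := M.inner_left_of_mem_orthogonal hd hq
    rwa [inner_sub_right, sub_eq_zero] at this

end SquareZero

section Block

variable {H : Type*} [NormedAddCommGroup H] [InnerProductSpace ℂ H]

/-- The operator `(a, b) ↦ (A a, B b)` on `H ⊕ H`. -/
noncomputable def diagBlock (A B : H →L[ℂ] H) : WithLp 2 (H × H) →L[ℂ] WithLp 2 (H × H) :=
  (WithLp.prodContinuousLinearEquiv 2 ℂ H H).symm.toContinuousLinearMap ∘L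
    A.prodMap B ∘L (WithLp.prodContinuousLinearEquiv 2 ℂ H H).toContinuousLinearMap

/-- The operator `(a, b) ↦ (A b, B a)` on `H ⊕ H`. -/
noncomputable def antidiagBlock (A B : H →L[ℂ] H) : WithLp 2 (H × H) →L[ℂ] WithLp 2 (H × H) :=
  (WithLp.prodContinuousLinearEquiv 2 ℂ H H).symm.toContinuousLinearMap ∘L
    ((A ∘L ContinuousLinearMap.snd ℂ H H).prod (B ∘L ContinuousLinearMap.fst ℂ H H)) ∘L
      (WithLp.prodContinuousLinearEquiv 2 ℂ H H).toContinuousLinearMap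

@[simp] lemma diagBlock_fst (A B : H →L[ℂ] H) (p : WithLp 2 (H × H)) :
    (diagBlock A B p).fst = A p.fst := rfl

@[simp] lemma diagBlock_snd (A B : H →L[ℂ] H) (p : WithLp 2 (H × H)) :
    (diagBlock A B p).snd = B p.snd := rfl

@[simp] lemma antidiagBlock_fst (A B : H →L[ℂ] H) (p : WithLp 2 (H × H)) :
    (antidiagBlock A B p).fst = A p.snd := rfl

@[simp] lemma antidiagBlock_snd (A B : H →L[ℂ] H) (p : WithLp 2 (H × H)) :
    (antidiagBlock A B p).snd = B p.fst := rfl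

lemma norm_diagBlock_le {A B : H →L[ℂ] H} {c : ℝ} (hA : ‖A‖ ≤ c) (hB : ‖B‖ ≤ c) :
    ‖diagBlock A B‖ ≤ c := by
  have hc : 0 ≤ c := (norm_nonneg _).trans hA
  refine ContinuousLinearMap.opNorm_le_bound _ hc fun p => le_of_sq_le_sq ?_ (by positivity)
  rw [mul_pow, WithLp.prod_norm_sq_eq_of_L2, WithLp.prod_norm_sq_eq_of_L2 p, mul_add, ← mul_pow,
    ← mul_pow]
  exact add_le_add (pow_le_pow_left₀ (norm_nonneg _) (A.le_of_opNorm_le hA _) 2)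
    (pow_le_pow_left₀ (norm_nonneg _) (B.le_of_opNorm_le hB _) 2)

lemma norm_antidiagBlock_le {A B : H →L[ℂ] H} {c : ℝ} (hA : ‖A‖ ≤ c) (hB : ‖B‖ ≤ c) :
    ‖antidiagBlock A B‖ ≤ c := by
  have hc : 0 ≤ c := (norm_nonneg _).trans hA
  refine ContinuousLinearMap.opNorm_le_bound _ hc fun p => le_of_sq_le_sq ?_ (by positivity)
  rw [mul_pow, WithLp.prod_norm_sq_eq_of_L2, WithLp.prod_norm_sq_eq_of_L2 p, mul_add, ← mul_pow,
    ← mul_pow, add_comm ((c * _) ^ 2)]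
  exact add_le_add (pow_le_pow_left₀ (norm_nonneg _) (A.le_of_opNorm_le hA _) 2)
    (pow_le_pow_left₀ (norm_nonneg _) (B.le_of_opNorm_le hB _) 2)

end Block

section Relation

variable {H : Type*} [NormedAddCommGroup H] [InnerProductSpace ℂ H]

/-- The graph of the operator with block matrix `(D, d; -d⁻¹ R, -D)`, where `D` has graph `Γ`. -/
def doubledGraph (Γ : Submodule ℂ (H × H)) (R : H →L[ℂ] H) (d : ℂ) :
    Submodule ℂ (WithLp 2 (H × H) × WithLp 2 (H × H)) where
  carrier := {pq | (pq.1.fst, pq.2.fst - d • pq.1.snd) ∈ Γ ∧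
    (pq.1.snd, -pq.2.snd - d⁻¹ • R pq.1.fst) ∈ Γ}
  zero_mem' := by simp [← Prod.zero_eq_mk]
  add_mem' := by
    rintro ⟨p, q⟩ ⟨p', q'⟩ ⟨h1, h2⟩ ⟨h1', h2'⟩
    refine ⟨?_, ?_⟩
    · convert Γ.add_mem h1 h1' using 1
      ext <;> simp; module
    · convert Γ.add_mem h2 h2' using 1
      ext <;> simp; module
  smul_mem' := by
    rintro c ⟨p, q⟩ ⟨h1, h2⟩
    refine ⟨?_, ?_⟩
    · convert Γ.smul_mem c h1 using 1
      ext <;> simp; module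
    · convert Γ.smul_mem c h2 using 1
      ext <;> simp; module

lemma mem_doubledGraph {Γ : Submodule ℂ (H × H)} {R : H →L[ℂ] H} {d : ℂ}
    {p q : WithLp 2 (H × H)} :
    (p, q) ∈ doubledGraph Γ R d ↔
      (p.fst, q.fst - d • p.snd) ∈ Γ ∧ (p.snd, -q.snd - d⁻¹ • R p.fst) ∈ Γ := Iff.rfl

/-- The kernel of the operator with graph `doubledGraph Γ R d`: the pairs `(a, -d⁻¹ D a)`. -/
def doubledKernel (Γ : Submodule ℂ (H × H)) (d : ℂ) : Submodule ℂ (WithLp 2 (H × H)) where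
  carrier := {p | (p.fst, -(d • p.snd)) ∈ Γ}
  zero_mem' := by simp [← Prod.zero_eq_mk]
  add_mem' := by
    intro p q hp hq
    change (_, _) ∈ Γ
    convert Γ.add_mem hp hq using 1
    ext <;> simp; abel
  smul_mem' := by
    intro c p hp
    change (_, _) ∈ Γ
    convert Γ.smul_mem c hp using 1
    ext <;> simp; module

lemma mem_doubledKernel {Γ : Submodule ℂ (H × H)} {d : ℂ} {p : WithLp 2 (H × H)} :
    p ∈ doubledKernel Γ d ↔ (p.fst, -(d • p.snd)) ∈ Γ := Iff.rfl

lemma isClosed_doubledKernel {Γ : Submodule ℂ (H × H)} (hΓ : IsClosed (Γ : Set (H × H))) (d : ℂ) :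
    IsClosed (doubledKernel Γ d : Set (WithLp 2 (H × H))) := by
  have hc : Continuous fun p : WithLp 2 (H × H) => (p.fst, -(d • p.snd)) := by fun_prop
  exact hΓ.preimage hc

variable {Γ : Submodule ℂ (H × H)} {R : H →L[ℂ] H} {d : ℂ}

lemma mem_doubledGraph_of_mem_doubledKernel (hd : d ≠ 0) (hR : ∀ a b, (a, b) ∈ Γ → (b, R a) ∈ Γ)
    {p : WithLp 2 (H × H)} (hp : p ∈ doubledKernel Γ d) : (p, 0) ∈ doubledGraph Γ R d := by
  rw [mem_doubledKernel] at hp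
  refine mem_doubledGraph.2 ⟨by simpa using hp, ?_⟩
  convert Γ.smul_mem (-d⁻¹) (hR _ _ hp) using 1
  ext <;> simp [smul_smul, hd]

lemma snd_mem_doubledKernel (hd : d ≠ 0) (hR : ∀ a b, (a, b) ∈ Γ → (b, R a) ∈ Γ)
    {p q : WithLp 2 (H × H)} (hpq : (p, q) ∈ doubledGraph Γ R d) : q ∈ doubledKernel Γ d := by
  obtain ⟨h1, h2⟩ := mem_doubledGraph.1 hpq
  rw [mem_doubledKernel]
  convert Γ.add_mem (hR _ _ h1) (Γ.smul_mem d h2) using 1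
  ext <;> simp [smul_sub, smul_smul, hd]

/-- A homotopy for the operator with graph `doubledGraph Γ R d`. -/
noncomputable def doubledHomotopy (d : ℂ) (x y' s : H →L[ℂ] H) :
    WithLp 2 (H × H) →L[ℂ] WithLp 2 (H × H) :=
  diagBlock (x ∘L y') (-(x ∘L y')) + antidiagBlock 0 (d⁻¹ • (x ∘L s))

lemma doubledHomotopy_mem_doubledGraph (hd : d ≠ 0) (hR : ∀ a b, (a, b) ∈ Γ → (b, R a) ∈ Γ)
    {x y y' s : H →L[ℂ] H} (hx : ∀ a b, (a, b) ∈ Γ → (x a, y a - x b) ∈ Γ)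
    (hy' : ∀ a b, (a, b) ∈ Γ → (y' a, y' b + s a) ∈ Γ)
    (hyy' : ∀ a, y (y' a) = a) (hys : ∀ a, y (s a) = x (R (y' a)) - R (x (y' a)))
    {p q : WithLp 2 (H × H)} (hpq : (p, q) ∈ doubledGraph Γ R d) :
    (doubledHomotopy d x y' s p, p - doubledHomotopy d x y' s q) ∈ doubledGraph Γ R d := by
  obtain ⟨h1, h2⟩ := mem_doubledGraph.1 hpq
  set a := p.fst
  set b := p.snd
  obtain ⟨a₁, ha₁⟩ : ∃ a₁, q.fst = a₁ + d • b := ⟨q.fst - d • b, by simp⟩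
  obtain ⟨b₁, hb₁⟩ : ∃ b₁, q.snd = -b₁ - d⁻¹ • R a := ⟨-q.snd - d⁻¹ • R a, by simp⟩
  rw [ha₁, add_sub_cancel_right] at h1
  rw [hb₁, show -(-b₁ - d⁻¹ • R a) - d⁻¹ • R a = b₁ by abel] at h2
  have hya := hy' _ _ h1
  have hsa := Γ.sub_mem (hR _ _ hya) (hy' _ _ (hR _ _ h1))
  simp only [Prod.mk_sub_mk, add_sub_cancel_left] at hsa
  refine mem_doubledGraph.2 ⟨?_, ?_⟩
  · convert hx _ _ hya using 1
    have : p.fst = a ∧ p.snd = b := ⟨rfl, rfl⟩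
    ext <;> simp [doubledHomotopy, ha₁, hyy', smul_smul, hd, this]
    abel
  · convert Γ.add_mem (Γ.smul_mem (-1 : ℂ) (hx _ _ (hy' _ _ h2))) (Γ.smul_mem d⁻¹ (hx _ _ hsa))
      using 1
    have : p.fst = a ∧ p.snd = b := ⟨rfl, rfl⟩
    ext <;> simp [doubledHomotopy, ha₁, hb₁, hyy', smul_smul, hd, hys, this]
    module

end Relation

namespace LinearPMap

variable {H : Type*} [NormedAddCommGroup H] [InnerProductSpace ℂ H]

/-- A densely defined operator with bounded square has a bounded operator extending its square. -/
lemma exists_clm_extending_sq [CompleteSpace H] (T : H →ₗ.[ℂ] H)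
    (hdense : Dense (T.domain : Set H)) {c : ℝ} (hc : 0 ≤ c)
    (hran : ∀ v : T.domain, T v ∈ T.domain)
    (hsq : ∀ v : T.domain, ‖T ⟨T v, hran v⟩‖ ≤ c * ‖(v : H)‖) :
    ∃ R : H →L[ℂ] H, ‖R‖ ≤ c ∧ ∀ v : T.domain, R v = T ⟨T v, hran v⟩ := by
  let f : T.domain →ₗ[ℂ] H := T.toFun ∘ₗ T.toFun.codRestrict T.domain hran
  have hd : DenseRange T.domain.subtype := hdense.denseRange_val
  exact ⟨f.extendOfNorm T.domain.subtype, LinearMap.opNorm_extendOfNorm_le hd hc hsq,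
    fun v => LinearMap.extendOfNorm_eq hd ⟨c, hsq⟩ v⟩

/-- A pair `(v, z)` with `⟪z, u⟫ = ⟪v, T u⟫` for all `u` lies in the graph of `T†`, so `T + T†`
is `T v + z` at `v`. -/
lemma exists_add_adjoint_apply [CompleteSpace H] {T : H →ₗ.[ℂ] H}
    (hdense : Dense (T.domain : Set H)) {v t z : H} (hv : (v, t) ∈ T.graph)
    (hz : ∀ a b, (a, b) ∈ T.graph → ⟪z, a⟫_ℂ = ⟪v, b⟫_ℂ) :
    ∃ h : v ∈ (T + T.adjoint).domain, (T + T.adjoint) ⟨v, h⟩ = t + z := by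
  obtain ⟨⟨v', hv'⟩, rfl, rfl⟩ := (mem_graph_iff T).1 hv
  have hz' : ∀ u : T.domain, ⟪z, u⟫_ℂ = ⟪v', T u⟫_ℂ := fun u => hz _ _ (T.mem_graph u)
  have hadj := mem_adjoint_domain_of_exists v' ⟨z, hz'⟩
  refine ⟨⟨hv', hadj⟩, ?_⟩
  rw [add_apply]
  exact congrArg _ (adjoint_apply_eq hdense ⟨v', hadj⟩ hz')

lemma add_adjoint_isFormalAdjoint [CompleteSpace H] {T : H →ₗ.[ℂ] H}
    (hdense : Dense (T.domain : Set H)) :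
    (T + T.adjoint).IsFormalAdjoint (T + T.adjoint) := by
  intro v w
  have hadj := adjoint_isFormalAdjoint hdense
  rw [add_apply, add_apply, inner_add_left, inner_add_right, add_comm]
  exact congrArg₂ (· + ·) (hadj ⟨v, v.2.2⟩ ⟨w, w.2.1⟩) (hadj.symm ⟨v, v.2.1⟩ ⟨w, w.2.2⟩)

/-- A symmetric operator with a bounded right inverse is invertible. -/
lemma IsFormalAdjoint.isBoundedInvertible {D : H →ₗ.[ℂ] H} (hD : D.IsFormalAdjoint D)
    (B : H →L[ℂ] H) (hB : ∀ w, ∃ h : B w ∈ D.domain, D ⟨B w, h⟩ = w) :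
    D.IsBoundedInvertible := by
  refine ⟨B, fun v => ?_, hB⟩
  obtain ⟨h, hDB⟩ := hB (D v)
  have hker : D (⟨B (D v), h⟩ - v) = 0 := by rw [map_sub, hDB, sub_self]
  obtain ⟨h', hDB'⟩ := hB (B (D v) - v)
  have := hD (⟨B (D v), h⟩ - v) ⟨_, h'⟩
  rw [hker, hDB', inner_zero_left] at this
  exact sub_eq_zero.1 (inner_self_eq_zero.1 this.symm)

variable {T : H →ₗ.[ℂ] H} (hran : ∀ v : T.domain, T v ∈ T.domain)
  {x y y' R : H →L[ℂ] H} (hx : ∀ v : T.domain, x (v : H) ∈ T.domain)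

lemma graph_sq_mem (hR : ∀ v : T.domain, R v = T ⟨T v, hran v⟩) {a b : H}
    (hab : (a, b) ∈ T.graph) : (b, R a) ∈ T.graph := by
  obtain ⟨v, rfl, rfl⟩ := (mem_graph_iff T).1 hab
  rw [hR]
  exact T.mem_graph ⟨T v, hran v⟩

lemma graph_anticommutator_mem (hxy : ∀ v : T.domain, x (T v) + T ⟨x (v : H), hx v⟩ = y (v : H))
    {a b : H} (hab : (a, b) ∈ T.graph) : (x a, y a - x b) ∈ T.graph := by
  obtain ⟨v, rfl, rfl⟩ := (mem_graph_iff T).1 hab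
  have := T.mem_graph ⟨x v, hx v⟩
  rwa [← eq_sub_of_add_eq' (hxy v)]

lemma graph_inverse_mem (hR : ∀ a b, (a, b) ∈ T.graph → (b, R a) ∈ T.graph)
    (hx : ∀ a b, (a, b) ∈ T.graph → (x a, y a - x b) ∈ T.graph)
    (hyy' : ∀ a, y (y' a) = a) (hy'y : ∀ a, y' (y a) = a)
    (hy' : ∀ v : T.domain, y' (v : H) ∈ T.domain) {a b : H} (hab : (a, b) ∈ T.graph) :
    (y' a, y' b + y' (x (R (y' a)) - R (x (y' a)))) ∈ T.graph := by
  have ha : a ∈ T.domain := mem_domain_of_mem_graph hab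
  obtain ⟨c, hc⟩ := mem_domain_iff.1 (hy' ⟨a, ha⟩)
  have hxa := hx _ _ hc
  have hsum := T.graph.add_mem (hR _ _ hxa) (hx _ _ (hR _ _ hc))
  simp only [Prod.mk_add_mk, sub_add_cancel, hyy'] at hsum
  have hb : b = R (x (y' a)) + (y c - x (R (y' a))) := T.mem_graph_snd_inj hab hsum rfl
  have hc' : c = y' b + y' (x (R (y' a)) - R (x (y' a))) := by
    rw [hb, _root_.map_add, _root_.map_sub, hy'y, _root_.map_sub]
    abel
  rwa [← hc']

end LinearPMap

/-- The strict bound `4 ε k < 1` with `0 ≤ ε` persists for some positive `δ ≥ ε`. -/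
lemma exists_pos_ge_mul_lt {ε k : ℝ} (hε : 0 ≤ ε) (hk : 0 ≤ k) (h : 4 * ε * k < 1) :
    ∃ δ : ℝ, 0 < δ ∧ ε ≤ δ ∧ 4 * δ * k < 1 := by
  rcases hε.eq_or_lt with rfl | hpos
  · refine ⟨1 / (4 * (k + 1)), by positivity, by positivity, ?_⟩
    rw [← sub_pos]
    have : 1 - 4 * (1 / (4 * (k + 1))) * k = 1 / (k + 1) := by field_simp; ring
    rw [this]
    positivity
  · exact ⟨ε, hpos, le_rfl, h⟩

lemma norm_doubledHomotopy_le {H : Type*} [NormedAddCommGroup H] [InnerProductSpace ℂ H]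
    {δ K : ℝ} (hδ : 0 < δ) {x y' R : H →L[ℂ] H} (hxn : ‖x‖ ≤ K) (hyn : ‖y'‖ ≤ K)
    (hRn : ‖R‖ ≤ δ ^ 2) :
    ‖doubledHomotopy (δ : ℂ) x y' (y' ∘L (x ∘L R - R ∘L x) ∘L y')‖ ≤
      K ^ 2 * (1 + 2 * (δ * K ^ 2)) := by
  have hK : 0 ≤ K := (norm_nonneg _).trans hxn
  have hxy : ‖x ∘L y'‖ ≤ K ^ 2 :=
    (x.opNorm_comp_le y').trans (by rw [sq]; gcongr)
  have hcomm : ‖x ∘L R - R ∘L x‖ ≤ 2 * K * δ ^ 2 := by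
    calc _ ≤ ‖x‖ * ‖R‖ + ‖R‖ * ‖x‖ :=
        (norm_sub_le _ _).trans (add_le_add (x.opNorm_comp_le R) (R.opNorm_comp_le x))
      _ ≤ K * δ ^ 2 + δ ^ 2 * K := by gcongr
      _ = _ := by ring
  have hs : ‖y' ∘L (x ∘L R - R ∘L x) ∘L y'‖ ≤ K * (2 * K * δ ^ 2 * K) := by
    refine (y'.opNorm_comp_le _).trans ?_
    gcongr
    refine (ContinuousLinearMap.opNorm_comp_le _ _).trans ?_
    gcongr
  have hlow : ‖(δ : ℂ)⁻¹ • (x ∘L y' ∘L (x ∘L R - R ∘L x) ∘L y')‖ ≤ 2 * δ * K ^ 4 := by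
    rw [norm_smul, norm_inv, Complex.norm_of_nonneg hδ.le]
    calc _ ≤ δ⁻¹ * (K * (K * (2 * K * δ ^ 2 * K))) := by
          gcongr
          refine (x.opNorm_comp_le _).trans ?_
          gcongr
      _ = _ := by field_simp
  calc ‖doubledHomotopy (δ : ℂ) x y' (y' ∘L (x ∘L R - R ∘L x) ∘L y')‖
      ≤ K ^ 2 + 2 * δ * K ^ 4 := by
        rw [doubledHomotopy]
        refine (ContinuousLinearMap.opNorm_add_le _ _).trans (add_le_add ?_ ?_)
        · exact norm_diagBlock_le hxy (by rwa [norm_neg])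
        · exact norm_antidiagBlock_le (by rw [norm_zero]; positivity) hlow
    _ = _ := by ring

lemma norm_smul_id_sub_smul_le {H : Type*} [NormedAddCommGroup H] [InnerProductSpace ℂ H]
    {δ : ℝ} (hδ : 0 < δ) {R : H →L[ℂ] H} (hRn : ‖R‖ ≤ δ ^ 2) :
    ‖(δ : ℂ) • ContinuousLinearMap.id ℂ H - (δ : ℂ)⁻¹ • R‖ ≤ 2 * δ := by
  refine (norm_sub_le _ _).trans ?_
  rw [norm_smul, norm_smul, norm_inv, Complex.norm_of_nonneg hδ.le]
  calc _ ≤ δ * 1 + δ⁻¹ * δ ^ 2 := by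
        gcongr
        exact ContinuousLinearMap.norm_id_le
    _ = 2 * δ := by field_simp; ring

/-- If `T'` has graph `doubledGraph T.graph R d`, then `T' + T'*` is the sum of `D ⊕ -D` and a
bounded operator, where `D = T + T*`. This is the component `D`. -/
lemma LinearPMap.exists_add_adjoint_apply_of_doubledGraph {H : Type*} [NormedAddCommGroup H]
    [InnerProductSpace ℂ H] [CompleteSpace H] {T : H →ₗ.[ℂ] H}
    (hdense : Dense (T.domain : Set H)) {R : H →L[ℂ] H} {δ : ℝ}
    {p t z : WithLp 2 (H × H)} (ht : (p, t) ∈ doubledGraph T.graph R δ)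
    (hz : ∀ u v, (u, v) ∈ doubledGraph T.graph R δ → ⟪z, u⟫_ℂ = ⟪p, v⟫_ℂ) :
    ∃ h : p.fst ∈ (T + T.adjoint).domain, (T + T.adjoint) ⟨p.fst, h⟩ =
      (t + z).fst - ((δ : ℂ) • ContinuousLinearMap.id ℂ H - (δ : ℂ)⁻¹ • R).adjoint p.snd := by
  obtain ⟨h1, -⟩ := mem_doubledGraph.1 ht
  have key : ∀ a b, (a, b) ∈ T.graph →
      ⟪z.fst + (δ : ℂ)⁻¹ • R.adjoint p.snd, a⟫_ℂ = ⟪p.fst, b⟫_ℂ := by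
    intro a b hab
    have := hz (WithLp.toLp 2 (a, 0)) (WithLp.toLp 2 (b, -((δ : ℂ)⁻¹ • R a)))
      (mem_doubledGraph.2 ⟨by simpa using hab, by simp⟩)
    simp only [WithLp.prod_inner_apply] at this
    simp [inner_smul_right] at this
    rw [inner_add_left, inner_smul_left, ContinuousLinearMap.adjoint_inner_left]
    simp [this]
  obtain ⟨h, hD⟩ := exists_add_adjoint_apply hdense h1 key
  refine ⟨h, hD.trans ?_⟩
  have hS : ((δ : ℂ) • ContinuousLinearMap.id ℂ H - (δ : ℂ)⁻¹ • R).adjoint p.snd =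
      (δ : ℂ) • p.snd - (δ : ℂ)⁻¹ • R.adjoint p.snd := by
    refine ext_inner_right ℂ fun u => ?_
    rw [ContinuousLinearMap.adjoint_inner_left]
    simp [inner_sub_left, inner_sub_right, inner_smul_left, inner_smul_right,
      ContinuousLinearMap.adjoint_inner_left, -Complex.coe_smul]
  rw [hS, WithLp.add_fst]
  abel

/-- Let `∇` (here `T`) be a closed, densely defined operator on a complex Hilbert space `H`
with `ran ∇ ⊆ dom ∇` and `‖∇²‖ ≤ ε²`, and suppose there are bounded operators `x`, `y` with
`x (dom ∇) ⊆ dom ∇`, `x∇ + ∇x = y` on `dom ∇`, `y` invertible with inverse `y'`,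
`y' (dom ∇) ⊆ dom ∇`, `‖x‖ ≤ K`, `‖y'‖ ≤ K`, where `4 ε K² < 1`.
Then `∇ + ∇*` (with domain `dom ∇ ∩ dom ∇*`) is invertible. -/
theorem statement0 {H : Type*} [NormedAddCommGroup H] [InnerProductSpace ℂ H]
    [CompleteSpace H] (T : H →ₗ.[ℂ] H)
    (hdense : Dense (T.domain : Set H)) (hclosed : T.IsClosed)
    (ε K : ℝ) (hε : 0 ≤ ε) (hεK : 4 * ε * K ^ 2 < 1)
    (hran : ∀ v : T.domain, T v ∈ T.domain)
    (hsq : ∀ v : T.domain, ‖T ⟨T v, hran v⟩‖ ≤ ε ^ 2 * ‖(v : H)‖)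
    (x y y' : H →L[ℂ] H)
    (hx : ∀ v : T.domain, x (v : H) ∈ T.domain)
    (hxy : ∀ v : T.domain, x (T v) + T ⟨x (v : H), hx v⟩ = y (v : H))
    (hy1 : y.comp y' = ContinuousLinearMap.id ℂ H)
    (hy2 : y'.comp y = ContinuousLinearMap.id ℂ H)
    (hy' : ∀ v : T.domain, y' (v : H) ∈ T.domain)
    (hxn : ‖x‖ ≤ K) (hyn : ‖y'‖ ≤ K) :
    (T + T.adjoint).IsBoundedInvertible := by
  obtain ⟨δ, hδ, hεδ, hδK⟩ := exists_pos_ge_mul_lt hε (sq_nonneg K) hεK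
  have hd : (δ : ℂ) ≠ 0 := by exact_mod_cast hδ.ne'
  obtain ⟨R, hRn, hRT⟩ := T.exists_clm_extending_sq hdense (sq_nonneg ε) hran hsq
  replace hRn : ‖R‖ ≤ δ ^ 2 := hRn.trans (by gcongr)
  have hyy' (a : H) : y (y' a) = a := DFunLike.congr_fun hy1 a
  have hy'y (a : H) : y' (y a) = a := DFunLike.congr_fun hy2 a
  have hR (a b : H) (hab : (a, b) ∈ T.graph) : (b, R a) ∈ T.graph :=
    LinearPMap.graph_sq_mem hran hRT hab
  have hxΓ (a b : H) (hab : (a, b) ∈ T.graph) : (x a, y a - x b) ∈ T.graph :=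
    LinearPMap.graph_anticommutator_mem hx hxy hab
  let s : H →L[ℂ] H := y' ∘L (x ∘L R - R ∘L x) ∘L y'
  have hyΓ (a b : H) (hab : (a, b) ∈ T.graph) : (y' a, y' b + s a) ∈ T.graph :=
    LinearPMap.graph_inverse_mem hR hxΓ hyy' hy'y hy' hab
  let M := doubledKernel T.graph (δ : ℂ)
  have : CompleteSpace M := (isClosed_doubledKernel hclosed _).completeSpace_coe
  let h := doubledHomotopy (δ : ℂ) x y' s
  let B := hodgeInverse M h
  have hBn : ‖B‖ ≤ K ^ 2 * (1 + 2 * (δ * K ^ 2)) :=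
    (norm_hodgeInverse_le M h).trans (norm_doubledHomotopy_le hδ hxn hyn hRn)
  let S : H →L[ℂ] H := (δ : ℂ) • ContinuousLinearMap.id ℂ H - (δ : ℂ)⁻¹ • R
  have hSn : ‖S‖ ≤ 2 * δ := norm_smul_id_sub_smul_le hδ hRn
  let E := antidiagBlock S.adjoint S
  have hEn : ‖E‖ ≤ 2 * δ := norm_antidiagBlock_le (by rwa [LinearIsometryEquiv.norm_map]) hSn
  have hEB : ‖E * B‖ < 1 := by
    calc ‖E * B‖ ≤ 2 * δ * (K ^ 2 * (1 + 2 * (δ * K ^ 2))) :=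
          (norm_mul_le _ _).trans (by gcongr)
      _ < 1 := by nlinarith [mul_nonneg hδ.le (sq_nonneg K)]
  let C : WithLp 2 (H × H) →L[ℂ] WithLp 2 (H × H) := ↑(Units.oneSub (E * B) hEB)⁻¹
  have hC (w : WithLp 2 (H × H)) : C w - E (B (C w)) = w :=
    DFunLike.congr_fun (Units.oneSub (E * B) hEB).mul_inv w
  let L : H →L[ℂ] H := WithLp.fstL 2 ℂ H H ∘L B ∘L C ∘L
    (WithLp.prodContinuousLinearEquiv 2 ℂ H H).symm.toContinuousLinearMap ∘L
      ContinuousLinearMap.inl ℂ H H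
  refine (LinearPMap.add_adjoint_isFormalAdjoint hdense).isBoundedInvertible L fun w => ?_
  obtain ⟨t, z, ht, htz, hz⟩ := exists_hodgeInverse_decomposition (doubledGraph T.graph R δ) M h
    (fun m hm => mem_doubledGraph_of_mem_doubledKernel hd hR hm)
    (fun u v huv => snd_mem_doubledKernel hd hR huv)
    (fun u v huv => doubledHomotopy_mem_doubledGraph hd hR hxΓ hyΓ hyy' (fun a => hyy' _) huv)
    (C (WithLp.toLp 2 (w, 0)))
  obtain ⟨hdom, hD⟩ := LinearPMap.exists_add_adjoint_apply_of_doubledGraph hdense ht hz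
  refine ⟨hdom, hD.trans ?_⟩
  rw [htz]
  exact congrArg WithLp.fst (hC (WithLp.toLp 2 (w, 0)))
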